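/- Let m, n be positive integers, 0 ≤ t ≤ min(m,n), and let w₁, w₂ be m×n partial permutation matrices of rank t. Then B_m⁺ w₁ B_n⁺ ∩ B_m⁻ w₂ B_n⁻ is nonempty if and only if dom(w₁) ≤ dom(w₂) and rng(w₁) ≥ rng(w₂). -/

import Mathlib

open Matrix

noncomputable section

abbrev Mat (k l : ℕ) := Matrix (Fin k) (Fin l) ℂ

/-- permutation matrix: (i,j) entry is 1 exactly when i = w j -/
def permMat (k : ℕ) (w : Equiv.Perm (Fin k)) : Mat k k :=
  fun i j => if i = w j then 1 else 0

/-- invertible upper triangular matrices -/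
def Bp (k : ℕ) : Set (Mat k k) := {M | IsUnit M ∧ ∀ i j : Fin k, j < i → M i j = 0}

/-- invertible lower triangular matrices -/
def Bm (k : ℕ) : Set (Mat k k) := {M | IsUnit M ∧ ∀ i j : Fin k, i < j → M i j = 0}

def dcPlus {k l : ℕ} (w : Mat k l) : Set (Mat k l) :=
  {x | ∃ b ∈ Bp k, ∃ b' ∈ Bp l, x = b * w * b'}

def dcMinus {k l : ℕ} (w : Mat k l) : Set (Mat k l) :=
  {x | ∃ b ∈ Bm k, ∃ b' ∈ Bm l, x = b * w * b'}

/-- comparison of finsets: sorted lists compare termwise -/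
def finsetLE {k : ℕ} (A B : Finset (Fin k)) : Prop :=
  List.Forall₂ (· ≤ ·) (A.sort (· ≤ ·)) (B.sort (· ≤ ·))

/-- Bruhat order on S_k -/
def bruhatLE {k : ℕ} (y z : Equiv.Perm (Fin k)) : Prop :=
  ∀ p : Fin k, finsetLE ((Finset.Iic p).image y) ((Finset.Iic p).image z)

/-- Zariski closure in the space of k×l matrices -/
def zClosure {k l : ℕ} (S : Set (Mat k l)) : Set (Mat k l) :=
  {x | ∀ p : MvPolynomial (Fin k × Fin l) ℂ,
      (∀ y ∈ S, MvPolynomial.eval (fun q => y q.1 q.2) p = 0) →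
      MvPolynomial.eval (fun q => x q.1 q.2) p = 0}

def revP (k : ℕ) : Equiv.Perm (Fin k) := ⟨Fin.rev, Fin.rev, Fin.rev_rev, Fin.rev_rev⟩

def fe (m n : ℕ) : Fin n ⊕ Fin m ≃ Fin (m + n) :=
  finSumFinEquiv.trans (finCongr (Nat.add_comm n m))

/-- the block matrix [[w∘ⁿ, 0],[x, w∘ᵐ]] -/
def embMat (m n : ℕ) (x : Mat m n) : Mat (m+n) (m+n) :=
  Matrix.reindex (fe m n) (fe m n)
    (Matrix.fromBlocks (permMat n (revP n)) 0 x (permMat m (revP m)))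

/-- the permutation (w∘ⁿ,w∘ᵐ) ∈ S_{m+n} -/
def wnmPerm (m n : ℕ) : Equiv.Perm (Fin (m+n)) :=
  ((fe m n).symm.trans (Equiv.sumCongr (revP n) (revP m))).trans (fe m n)

def Pset (m n : ℕ) (w : Equiv.Perm (Fin (m+n))) : Set (Mat m n) :=
  {x | embMat m n x ∈ dcPlus (permMat (m+n) w)}

/-- the matrix with t×t identity in upper-left corner, zeros elsewhere -/
def Imn (m n t : ℕ) : Mat m n := fun i j => if (i:ℕ) = (j:ℕ) ∧ (i:ℕ) < t then 1 else 0

/-- diagonal matrix with first t diagonal entries 0 and the rest 1 -/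
def Jk (k t : ℕ) : Mat k k := fun i j => if (i:ℕ) = (j:ℕ) ∧ t ≤ (i:ℕ) then 1 else 0

noncomputable def subRank {k l : ℕ} (x : Mat k l) (R : Finset (Fin k)) (C : Finset (Fin l)) : ℕ :=
  (x.submatrix (fun i : {a // a ∈ R} => i.1) (fun j : {a // a ∈ C} => j.1)).rank

/-- v(1) < ⋯ < v(t) -/
def headMono {k : ℕ} (t : ℕ) (v : Equiv.Perm (Fin k)) : Prop :=
  ∀ i j : Fin k, i < j → (j:ℕ) < t → v i < v j

/-- u(t+1) < ⋯ < u(k) -/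
def tailMono {k : ℕ} (t : ℕ) (u : Equiv.Perm (Fin k)) : Prop :=
  ∀ i j : Fin k, i < j → t ≤ (i:ℕ) → u i < u j

def embPerm {k t : ℕ} (h : t ≤ k) (τ : Equiv.Perm (Fin t)) : Equiv.Perm (Fin k) :=
  τ.viaFintypeEmbedding (Fin.castLEEmb h)
/-- partial permutation matrix -/
def IsPPM {m n : ℕ} (w : Mat m n) : Prop :=
  (∀ i j, w i j = 0 ∨ w i j = 1) ∧
  (∀ i j j', w i j = 1 → w i j' = 1 → j = j') ∧
  (∀ i i' j, w i j = 1 → w i' j = 1 → i = i')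

/-- number of entries equal to 1 -/
noncomputable def ppmRank {m n : ℕ} (w : Mat m n) : ℕ :=
  {p : Fin m × Fin n | w p.1 p.2 = 1}.ncard

open scoped Classical in
/-- dom(w): columns containing a 1 -/
noncomputable def domPP {m n : ℕ} (w : Mat m n) : Finset (Fin n) :=
  Finset.univ.filter (fun j => ∃ i, w i j = 1)

open scoped Classical in
/-- rng(w): rows containing a 1 -/
noncomputable def rngPP {m n : ℕ} (w : Mat m n) : Finset (Fin m) :=
  Finset.univ.filter (fun i => ∃ j, w i j = 1)

lemma mem_Bp_of {k : ℕ} {M : Mat k k} (h : ∀ i j : Fin k, j < i → M i j = 0)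
    (hd : ∀ i, M i i ≠ 0) : M ∈ Bp k := by
  refine ⟨?_, h⟩
  rw [Matrix.isUnit_iff_isUnit_det, Matrix.det_of_upperTriangular (fun i j hij => h i j hij)]
  exact isUnit_iff_ne_zero.2 (Finset.prod_ne_zero_iff.2 fun i _ => hd i)

lemma Bp_diag {k : ℕ} {M : Mat k k} (h : M ∈ Bp k) (i : Fin k) : M i i ≠ 0 := by
  have h1 := h.1
  rw [Matrix.isUnit_iff_isUnit_det, Matrix.det_of_upperTriangular (fun i j hij => h.2 i j hij)] at h1
  exact Finset.prod_ne_zero_iff.1 (isUnit_iff_ne_zero.1 h1) i (Finset.mem_univ _)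

lemma Bp_mul {k : ℕ} {M N : Mat k k} (h : M ∈ Bp k) (h' : N ∈ Bp k) : M * N ∈ Bp k := by
  refine ⟨h.1.mul h'.1, fun i j hij => ?_⟩
  have a : M.BlockTriangular id := fun i j hij => h.2 i j hij
  have b : N.BlockTriangular id := fun i j hij => h'.2 i j hij
  exact a.mul b hij

lemma Bm_iff {k : ℕ} {M : Mat k k} : M ∈ Bm k ↔ Mᵀ ∈ Bp k := by
  simp only [Bm, Bp, Set.mem_setOf_eq, Matrix.isUnit_transpose, Matrix.transpose_apply]
  exact and_congr_right fun _ => forall_comm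

lemma Bp_iff {k : ℕ} {M : Mat k k} : M ∈ Bp k ↔ Mᵀ ∈ Bm k := by
  rw [Bm_iff, Matrix.transpose_transpose]

lemma Bm_mul {k : ℕ} {M N : Mat k k} (h : M ∈ Bm k) (h' : N ∈ Bm k) : M * N ∈ Bm k := by
  rw [Bm_iff, Matrix.transpose_mul]
  exact Bp_mul (Bm_iff.1 h') (Bm_iff.1 h)

lemma Bp_one {k : ℕ} : (1 : Mat k k) ∈ Bp k :=
  mem_Bp_of (fun i j h => Matrix.one_apply_ne h.ne') (fun i => by simp)

lemma mem_Bm_of {k : ℕ} {M : Mat k k} (h : ∀ i j : Fin k, i < j → M i j = 0)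
    (hd : ∀ i, M i i ≠ 0) : M ∈ Bm k :=
  Bm_iff.2 (mem_Bp_of (fun i j hij => h j i hij) hd)

lemma Bm_diag {k : ℕ} {M : Mat k k} (h : M ∈ Bm k) (i : Fin k) : M i i ≠ 0 :=
  Bp_diag (Bm_iff.1 h) i

/-- `[1] ⊕ p` -/
def emb1 {t : ℕ} (p : Mat t t) : Mat (t+1) (t+1) :=
  Matrix.of (Fin.cons (Fin.cons 1 0) (fun i => Fin.cons 0 (p i)))

@[simp] lemma emb1_00 {t : ℕ} (p : Mat t t) : emb1 p 0 0 = 1 := rfl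
@[simp] lemma emb1_0s {t : ℕ} (p : Mat t t) (j) : emb1 p 0 (Fin.succ j) = 0 := rfl
@[simp] lemma emb1_s0 {t : ℕ} (p : Mat t t) (j) : emb1 p (Fin.succ j) 0 = 0 := rfl
@[simp] lemma emb1_ss {t : ℕ} (p : Mat t t) (i j) : emb1 p (Fin.succ i) (Fin.succ j) = p i j := rfl

lemma emb1_Bp {t : ℕ} {p : Mat t t} (h : p ∈ Bp t) : emb1 p ∈ Bp (t+1) := by
  refine mem_Bp_of (fun i j hij => ?_) (fun i => ?_)
  · cases i using Fin.cases with
    | zero => exact absurd hij (Fin.not_lt_zero j)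
    | succ i =>
      cases j using Fin.cases with
      | zero => simp
      | succ j => simpa using h.2 i j (by simpa using hij)
  · cases i using Fin.cases with
    | zero => simp
    | succ i => simpa using Bp_diag h i

lemma exists_lower (t : ℕ) : ∀ g : Mat t t, IsUnit g → ∃ p ∈ Bp t, ∃ q ∈ Bp t, p * g * q ∈ Bm t := by
  induction t with
  | zero =>
    intro g hg
    exact ⟨1, Bp_one, 1, Bp_one, by simpa using hg, fun i => i.elim0⟩
  | succ t ih =>
    intro g hg
    -- step 1: make the corner nonzero
    have s1 : ∃ p ∈ Bp (t+1), (p * g) 0 0 ≠ 0 := by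
      by_cases h0 : g 0 0 = 0
      · have : ∃ r, g r 0 ≠ 0 := by
          by_contra! hc
          have := Matrix.det_eq_zero_of_column_eq_zero (A := g) 0 hc
          rw [Matrix.isUnit_iff_isUnit_det, this] at hg
          exact not_isUnit_zero hg
        obtain ⟨r, hr⟩ := this
        have hr0 : (0 : Fin (t+1)) ≠ r := by rintro rfl; exact hr h0
        refine ⟨Matrix.transvection 0 r 1, ?_, ?_⟩
        · refine mem_Bp_of (fun i j hij => ?_) (fun i => ?_)
          · have : i ≠ 0 := by rintro rfl; exact absurd hij (Fin.not_lt_zero j)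
            simp [Matrix.transvection, Matrix.one_apply_ne hij.ne', Matrix.single_apply, this.symm]
          · have : ¬ (0 = i ∧ r = i) := by rintro ⟨rfl, h⟩; exact hr0 h.symm
            simp [Matrix.transvection, Matrix.single_apply, this]
        · simp [h0, hr]
      · exact ⟨1, Bp_one, by simpa using h0⟩
    obtain ⟨p0, hp0, hc⟩ := s1
    set g1 := p0 * g with hg1
    have hg1u : IsUnit g1 := hp0.1.mul hg
    let q0 : Mat (t+1) (t+1) :=
      Matrix.of (Fin.cons (Fin.cons 1 (fun j => - g1 0 j.succ / g1 0 0))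
        (fun i => Fin.cons 0 ((1 : Mat t t) i)))
    have q00 : q0 0 0 = 1 := rfl
    have q0s : ∀ j : Fin t, q0 0 j.succ = - g1 0 j.succ / g1 0 0 := fun _ => rfl
    have qs0 : ∀ j : Fin t, q0 j.succ 0 = 0 := fun _ => rfl
    have qss : ∀ i j : Fin t, q0 i.succ j.succ = (1 : Mat t t) i j := fun _ _ => rfl
    have hq0 : q0 ∈ Bp (t+1) := by
      refine mem_Bp_of (fun i j hij => ?_) (fun i => ?_)
      · cases i using Fin.cases with
        | zero => exact absurd hij (Fin.not_lt_zero j)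
        | succ i =>
          cases j using Fin.cases with
          | zero => exact qs0 i
          | succ j => rw [qss]; exact Matrix.one_apply_ne (by rintro rfl; exact lt_irrefl _ hij)
      · cases i using Fin.cases with
        | zero => simp [q00]
        | succ i => simp [qss]
    set h := g1 * q0 with hh
    have hu : IsUnit h := hg1u.mul hq0.1
    have h00 : h 0 0 ≠ 0 := by
      rw [hh, Matrix.mul_apply, Fin.sum_univ_succ]
      simpa [q00, qs0] using hc
    have h0s : ∀ j : Fin t, h 0 j.succ = 0 := by
      intro j
      rw [hh, Matrix.mul_apply, Fin.sum_univ_succ]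
      simp only [q0s, qss, Matrix.one_apply, mul_ite, mul_one, mul_zero, Finset.sum_ite_eq',
        Finset.mem_univ, if_true]
      field_simp
      ring
    have hsub : IsUnit (h.submatrix Fin.succ Fin.succ) := by
      rw [Matrix.isUnit_iff_isUnit_det] at hu ⊢
      rw [Matrix.det_succ_row_zero, Fin.sum_univ_succ] at hu
      simp only [h0s] at hu
      simp at hu
      exact isUnit_iff_ne_zero.2 hu.2
    obtain ⟨p', hp', q', hq', hl⟩ := ih _ hsub
    refine ⟨emb1 p' * p0, Bp_mul (emb1_Bp hp') hp0, q0 * emb1 q', Bp_mul hq0 (emb1_Bp hq'), ?_⟩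
    have e : emb1 p' * p0 * g * (q0 * emb1 q') = emb1 p' * h * emb1 q' := by
      rw [hh, hg1]; simp only [Matrix.mul_assoc]
    rw [e]
    refine ⟨((emb1_Bp hp').1.mul hu).mul (emb1_Bp hq').1, fun i j hij => ?_⟩
    cases j using Fin.cases with
    | zero => exact absurd hij (Fin.not_lt_zero i)
    | succ j =>
      cases i using Fin.cases with
      | zero => simp [Matrix.mul_apply, Fin.sum_univ_succ, h0s]
      | succ i =>
        have := hl.2 i j (by simpa using hij)
        simpa [Matrix.mul_apply, Fin.sum_univ_succ, h0s] using this

lemma double_cell {t : ℕ} (a b : Mat t t) (ha : IsUnit a) (hb : IsUnit b) :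
    ∃ p ∈ Bp t, ∃ q ∈ Bp t, ∃ p' ∈ Bm t, ∃ q' ∈ Bm t, p * a * q = p' * b * q' := by
  obtain ⟨p1, hp1, q1, hq1, hl⟩ := exists_lower t a ha
  obtain ⟨p2, hp2, q2, hq2, hu⟩ := exists_lower t bᵀ (Matrix.isUnit_transpose b |>.2 hb)
  have hu' : q2ᵀ * b * p2ᵀ ∈ Bp t := by
    rw [Bp_iff]; simpa [Matrix.transpose_mul, Matrix.mul_assoc] using hu
  refine ⟨p1, hp1, q1 * (q2ᵀ * b * p2ᵀ), Bp_mul hq1 hu', (p1 * a * q1) * q2ᵀ,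
    Bm_mul hl (Bp_iff.1 hq2), p2ᵀ, Bp_iff.1 hp2, ?_⟩
  simp only [Matrix.mul_assoc]

/-- column selection matrix -/
def Esel {k t : ℕ} (s : Fin t ↪o Fin k) : Mat k t := fun i l => if i = s l then 1 else 0

def Apair {k t : ℕ} (r s : Fin t ↪o Fin k) : Mat k t := fun i l => if i = r l ∨ i = s l then 1 else 0

open scoped Classical in
def fillMat {k t : ℕ} (s : Fin t ↪o Fin k) (M : Mat k t) : Mat k k :=
  fun i j => if h : ∃ l, s l = j then M i h.choose else (1 : Mat k k) i j

lemma fillMat_apply {k t : ℕ} (s : Fin t ↪o Fin k) (M : Mat k t) (i l) :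
    fillMat s M i (s l) = M i l := by
  have h : ∃ l', s l' = s l := ⟨l, rfl⟩
  have e := s.injective h.choose_spec
  simp only [fillMat, dif_pos h]
  rw [e]

lemma fillMat_apply' {k t : ℕ} (s : Fin t ↪o Fin k) (M : Mat k t) (i j) (h : ¬ ∃ l, s l = j) :
    fillMat s M i j = (1 : Mat k k) i j := by
  simp only [fillMat, dif_neg h]

lemma fillMat_mul {k t : ℕ} (s : Fin t ↪o Fin k) (M : Mat k t) : fillMat s M * Esel s = M := by
  ext i l
  simp [Matrix.mul_apply, Esel, fillMat_apply]

lemma up_lemma {k t : ℕ} (r s : Fin t ↪o Fin k) (hrs : ∀ l, r l ≤ s l) (p : Mat t t) (hp : p ∈ Bp t) :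
    ∃ b ∈ Bp k, b * Esel s = Apair r s * p := by
  refine ⟨fillMat s (Apair r s * p), mem_Bp_of (fun i j hij => ?_) (fun i => ?_), fillMat_mul _ _⟩
  · by_cases h : ∃ l, s l = j
    · obtain ⟨l, rfl⟩ := h
      rw [fillMat_apply, Matrix.mul_apply]
      refine Finset.sum_eq_zero fun l' _ => ?_
      rcases lt_or_ge l l' with h | h
      · rw [hp.2 _ _ h, mul_zero]
      · have h1 := s.monotone h
        have h2 := hrs l'
        have : ¬ (i = r l' ∨ i = s l') := by
          rintro (h | h) <;> subst h
          · exact absurd (h2.trans h1) (not_le.2 hij)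
          · exact absurd h1 (not_le.2 hij)
        rw [show Apair r s _ l' = 0 from if_neg this, zero_mul]
    · rw [fillMat_apply' _ _ _ _ h]; exact Matrix.one_apply_ne hij.ne'
  · by_cases h : ∃ l, s l = i
    · obtain ⟨l, rfl⟩ := h
      rw [fillMat_apply, Matrix.mul_apply, Finset.sum_eq_single l]
      · simpa [Apair] using Bp_diag hp l
      · intro l' _ hne
        rcases lt_or_ge l l' with h | h
        · rw [hp.2 _ _ h, mul_zero]
        · have h1 := s.strictMono (lt_of_le_of_ne h hne)
          have h2 := hrs l'
          have : ¬ (s l = r l' ∨ s l = s l') := by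
            rintro (h | h)
            · exact absurd (h2.trans_lt h1) (not_lt.2 h.le)
            · exact h1.ne' h
          rw [show Apair r s _ l' = 0 from if_neg this, zero_mul]
      · simp
    · rw [fillMat_apply' _ _ _ _ h]; simp

lemma lo_lemma {k t : ℕ} (r s : Fin t ↪o Fin k) (hrs : ∀ l, r l ≤ s l) (p : Mat t t) (hp : p ∈ Bm t) :
    ∃ b ∈ Bm k, b * Esel r = Apair r s * p := by
  refine ⟨fillMat r (Apair r s * p), mem_Bm_of (fun i j hij => ?_) (fun i => ?_), fillMat_mul _ _⟩
  · by_cases h : ∃ l, r l = j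
    · obtain ⟨l, rfl⟩ := h
      rw [fillMat_apply, Matrix.mul_apply]
      refine Finset.sum_eq_zero fun l' _ => ?_
      rcases lt_or_ge l' l with h | h
      · rw [hp.2 _ _ h, mul_zero]
      · have h1 := r.monotone h
        have h2 := hrs l'
        have : ¬ (i = r l' ∨ i = s l') := by
          rintro (h | h) <;> subst h
          · exact absurd h1 (not_le.2 hij)
          · exact absurd (h1.trans h2) (not_le.2 hij)
        rw [show Apair r s _ l' = 0 from if_neg this, zero_mul]
    · rw [fillMat_apply' _ _ _ _ h]; exact Matrix.one_apply_ne hij.ne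
  · by_cases h : ∃ l, r l = i
    · obtain ⟨l, rfl⟩ := h
      rw [fillMat_apply, Matrix.mul_apply, Finset.sum_eq_single l]
      · simpa [Apair] using Bm_diag hp l
      · intro l' _ hne
        rcases lt_or_ge l' l with h | h
        · rw [hp.2 _ _ h, mul_zero]
        · have h1 := r.strictMono (lt_of_le_of_ne h hne.symm)
          have h2 := hrs l'
          have : ¬ (r l = r l' ∨ r l = s l') := by
            rintro (h | h)
            · exact h1.ne h
            · exact absurd (h1.trans_le h2) (not_lt.2 h.ge)
          rw [show Apair r s _ l' = 0 from if_neg this, zero_mul]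
      · simp
    · rw [fillMat_apply' _ _ _ _ h]; simp

/-! ### combinatorics -/

lemma mem_domPP {m n : ℕ} {w : Mat m n} {j} : j ∈ domPP w ↔ ∃ i, w i j = 1 := by
  simp [domPP]

lemma mem_rngPP {m n : ℕ} {w : Mat m n} {i} : i ∈ rngPP w ↔ ∃ j, w i j = 1 := by
  simp [rngPP]

lemma domPP_transpose {m n : ℕ} (w : Mat m n) : domPP wᵀ = rngPP w := by
  ext i; simp [mem_domPP, mem_rngPP]

lemma IsPPM.tr {m n : ℕ} {w : Mat m n} (h : IsPPM w) : IsPPM wᵀ :=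
  ⟨fun i j => h.1 j i, fun i j j' => h.2.2 j j' i, fun i i' j => h.2.1 j i i'⟩

lemma card_domPP {m n : ℕ} {w : Mat m n} (h : IsPPM w) : (domPP w).card = ppmRank w := by
  have : (domPP w : Set (Fin n)) = Prod.snd '' {p : Fin m × Fin n | w p.1 p.2 = 1} := by
    ext j; simp [mem_domPP]
  rw [← Set.ncard_coe_finset, this, Set.ncard_image_of_injOn]
  · rfl
  · rintro ⟨a, b⟩ ha ⟨a', b'⟩ ha' hb
    simp only at hb
    subst hb
    simp only [Set.mem_setOf_eq] at ha ha'
    rw [h.2.2 a a' b ha ha']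

lemma ppmRank_tr {m n : ℕ} (w : Mat m n) : ppmRank wᵀ = ppmRank w := by
  have : {p : Fin m × Fin n | w p.1 p.2 = 1} =
      Prod.swap '' {p : Fin n × Fin m | wᵀ p.1 p.2 = 1} := by
    ext ⟨a, b⟩; simp
  unfold ppmRank
  rw [this, Set.ncard_image_of_injective _ Prod.swap_injective]

lemma finsetLE_iff {k t : ℕ} {A B : Finset (Fin k)} (hA : A.card = t) (hB : B.card = t) :
    finsetLE A B ↔ ∀ l, A.orderEmbOfFin hA l ≤ B.orderEmbOfFin hB l := by
  unfold finsetLE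
  rw [List.forall₂_iff_get]
  simp only [Finset.length_sort, hA, hB, true_and]
  constructor
  · intro h l
    have := h l l.2 l.2
    simpa [Finset.orderEmbOfFin_apply] using this
  · intro h i h1 h2
    have := h ⟨i, h1⟩
    simpa [Finset.orderEmbOfFin_apply] using this

lemma finsetLE_of_count {k t : ℕ} {A B : Finset (Fin k)} (hA : A.card = t) (hB : B.card = t)
    (h : ∀ p, (B.filter (· < p)).card ≤ (A.filter (· < p)).card) : finsetLE A B := by
  rw [finsetLE_iff hA hB]
  intro l
  by_contra! hc
  have h1 := h (A.orderEmbOfFin hA l)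
  have h2 : (Finset.Iic l).map (B.orderEmbOfFin hB).toEmbedding ⊆
      B.filter (· < A.orderEmbOfFin hA l) := by
    intro x hx
    obtain ⟨a, ha, rfl⟩ := Finset.mem_map.1 hx
    refine Finset.mem_filter.2 ⟨Finset.orderEmbOfFin_mem _ _ _, lt_of_le_of_lt ?_ hc⟩
    exact (B.orderEmbOfFin hB).monotone (Finset.mem_Iic.1 ha)
  have h3 : A.filter (· < A.orderEmbOfFin hA l) ⊆
      (Finset.Iio l).map (A.orderEmbOfFin hA).toEmbedding := by
    intro x hx
    obtain ⟨hx1, hx2⟩ := Finset.mem_filter.1 hx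
    have : x ∈ Set.range (A.orderEmbOfFin hA) := by
      rw [Finset.range_orderEmbOfFin]; exact hx1
    obtain ⟨a, rfl⟩ := this
    refine Finset.mem_map.2 ⟨a, ?_, rfl⟩
    exact Finset.mem_Iio.2 ((A.orderEmbOfFin hA).lt_iff_lt.1 hx2)
  have h4 := Finset.card_le_card h2
  have h5 := Finset.card_le_card h3
  simp only [Finset.card_map, Fin.card_Iic, Fin.card_Iio] at h4 h5
  omega

/-! ### forward direction -/

lemma count_lemma {n : ℕ} (D₁ D₂ : Finset (Fin n)) (b c : Mat n n) (hb : b ∈ Bp n) (hc : c ∈ Bm n)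
    (h : ∀ k ∈ D₂, c k ∈ Submodule.span ℂ (Set.range fun j : D₁ => b j)) (p : Fin n) :
    (D₂.filter (· < p)).card ≤ (D₁.filter (· < p)).card := by
  let N : Mat n n := fun i => if i < p then c i else b i
  have hN : LinearIndependent ℂ N := by
    rw [Fintype.linearIndependent_iff]
    intro a ha
    have hv : ∀ j, ∑ i, a i * N i j = 0 := by
      intro j
      have := congrFun ha j
      rw [Finset.sum_apply] at this
      exact this
    have hlow : ∀ j, ∑ i, (if i < p then a i else 0) * c i j = 0 := by
      intro j
      rcases lt_or_ge j p with hj | hj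
      · refine Eq.trans (Finset.sum_congr rfl fun i _ => ?_) (hv j)
        by_cases hi : i < p
        · simp [N, hi]
        · simp [N, hi, hb.2 i j (lt_of_lt_of_le hj (not_lt.1 hi))]
      · refine Finset.sum_eq_zero fun i _ => ?_
        by_cases hi : i < p
        · rw [hc.2 i j (hi.trans_le hj), mul_zero]
        · simp [hi]
    have hlow' : (fun i => if i < p then a i else 0) = 0 := by
      apply Matrix.vecMul_injective_iff_isUnit.2 hc.1
      refine Eq.trans ?_ (Matrix.zero_vecMul _).symm
      ext j
      exact hlow j
    have hhigh : a = 0 := by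
      have ha0 : ∀ i, i < p → a i = 0 := fun i hi => by simpa [hi] using congrFun hlow' i
      apply Matrix.vecMul_injective_iff_isUnit.2 hb.1
      refine Eq.trans ?_ (Matrix.zero_vecMul _).symm
      ext j
      change ∑ i, a i * b i j = 0
      refine Eq.trans (Finset.sum_congr rfl fun i _ => ?_) (hv j)
      by_cases hi : i < p
      · simp [ha0 i hi]
      · simp [N, hi]
    intro i
    exact congrFun hhigh i
  let T : Finset (Fin n) := D₂.filter (· < p) ∪ D₁.filter (fun j => ¬ j < p)
  have hT : T.card = (D₂.filter (· < p)).card + (D₁.filter (fun j => ¬ j < p)).card := by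
    apply Finset.card_union_of_disjoint
    rw [Finset.disjoint_left]
    intro x hx hx'
    exact (Finset.mem_filter.1 hx').2 (Finset.mem_filter.1 hx).2
  let V := Submodule.span ℂ (Set.range fun j : D₁ => b j)
  have hmem : ∀ i : T, N i ∈ V := by
    rintro ⟨i, hi⟩
    rcases Finset.mem_union.1 hi with hi | hi
    · obtain ⟨h1, h2⟩ := Finset.mem_filter.1 hi
      simpa [N, h2] using h i h1
    · obtain ⟨h1, h2⟩ := Finset.mem_filter.1 hi
      simp only [N, h2, if_false]
      exact Submodule.subset_span ⟨⟨i, h1⟩, rfl⟩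
  have hli : LinearIndependent ℂ (fun i : T => (⟨N i, hmem i⟩ : V)) := by
    apply LinearIndependent.of_comp V.subtype
    exact hN.comp (fun i : T => (i : Fin n)) Subtype.val_injective
  have h1 := hli.fintype_card_le_finrank
  have h2 : Module.finrank ℂ V ≤ Fintype.card D₁ := finrank_range_le_card _
  have h3 : (D₁.filter (· < p)).card + (D₁.filter (fun j => ¬ j < p)).card = D₁.card :=
    Finset.card_filter_add_card_filter_not _
  simp only [Fintype.card_coe] at h1 h2
  omega

lemma forward_dom {m n t : ℕ} {w₁ w₂ : Mat m n} (h₁ : IsPPM w₁) (h₂ : IsPPM w₂)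
    (hr₁ : ppmRank w₁ = t) (hr₂ : ppmRank w₂ = t) {x : Mat m n} (hx : x ∈ dcPlus w₁)
    (hx' : x ∈ dcMinus w₂) : finsetLE (domPP w₁) (domPP w₂) := by
  obtain ⟨b, hb, b', hb', rfl⟩ := hx
  obtain ⟨c, hc, c', hc', he⟩ := hx'
  refine finsetLE_of_count ((card_domPP h₁).trans hr₁) ((card_domPP h₂).trans hr₂) ?_
  refine count_lemma _ _ b' c' hb' hc' ?_
  intro k hk
  obtain ⟨i, hi⟩ := mem_domPP.1 hk
  have e : w₂ * c' = (c⁻¹ * b * w₁) * b' := by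
    have hcd : IsUnit c.det := (Matrix.isUnit_iff_isUnit_det _).1 hc.1
    rw [Matrix.mul_assoc, Matrix.mul_assoc, ← Matrix.mul_assoc b, he, Matrix.mul_assoc c,
      Matrix.nonsing_inv_mul_cancel_left _ _ hcd]
  have e1 : c' k = (w₂ * c') i := by
    ext j
    rw [Matrix.mul_apply, Finset.sum_eq_single k]
    · rw [hi, one_mul]
    · intro k' _ hne
      rcases h₂.1 i k' with h | h
      · rw [h, zero_mul]
      · exact absurd (h₂.2.1 i _ _ h hi) hne
    · simp
  have e2 : (w₂ * c') i = ∑ j, (c⁻¹ * b * w₁) i j • b' j := by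
    rw [e]
    ext j
    simp [Matrix.mul_apply, Finset.sum_apply]
  rw [e1, e2]
  refine Submodule.sum_mem _ fun j _ => ?_
  by_cases hj : j ∈ domPP w₁
  · exact Submodule.smul_mem _ _ (Submodule.subset_span ⟨⟨j, hj⟩, rfl⟩)
  · have : (c⁻¹ * b * w₁) i j = 0 := by
      rw [Matrix.mul_apply]
      refine Finset.sum_eq_zero fun a _ => ?_
      rcases h₁.1 a j with h | h
      · rw [h, mul_zero]
      · exact absurd (mem_domPP.2 ⟨a, h⟩) hj
    rw [this, zero_smul]
    exact Submodule.zero_mem _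

lemma dcPlus_tr {m n : ℕ} {w x : Mat m n} (h : x ∈ dcPlus w) : xᵀ ∈ dcMinus wᵀ := by
  obtain ⟨b, hb, b', hb', rfl⟩ := h
  exact ⟨b'ᵀ, Bp_iff.1 hb', bᵀ, Bp_iff.1 hb, by simp [Matrix.transpose_mul, Matrix.mul_assoc]⟩

lemma dcMinus_tr {m n : ℕ} {w x : Mat m n} (h : x ∈ dcMinus w) : xᵀ ∈ dcPlus wᵀ := by
  obtain ⟨b, hb, b', hb', rfl⟩ := h
  exact ⟨b'ᵀ, Bm_iff.1 hb', bᵀ, Bm_iff.1 hb, by simp [Matrix.transpose_mul, Matrix.mul_assoc]⟩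

/-! ### backward direction -/

lemma ppm_decomp {m n t : ℕ} {w : Mat m n} (h : IsPPM w)
    (hD : (domPP w).card = t) (hR : (rngPP w).card = t) :
    IsUnit (w.submatrix ((rngPP w).orderEmbOfFin hR) ((domPP w).orderEmbOfFin hD)) ∧
    w = Esel ((rngPP w).orderEmbOfFin hR) *
      w.submatrix ((rngPP w).orderEmbOfFin hR) ((domPP w).orderEmbOfFin hD) *
      (Esel ((domPP w).orderEmbOfFin hD))ᵀ := by
  have hs : ∀ i ∈ rngPP w, ∃ a, (rngPP w).orderEmbOfFin hR a = i := by
    intro i hi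
    have : i ∈ Set.range ((rngPP w).orderEmbOfFin hR) := by
      rw [Finset.range_orderEmbOfFin]; exact hi
    exact this
  have hd : ∀ i ∈ domPP w, ∃ a, (domPP w).orderEmbOfFin hD a = i := by
    intro i hi
    have : i ∈ Set.range ((domPP w).orderEmbOfFin hD) := by
      rw [Finset.range_orderEmbOfFin]; exact hi
    exact this
  have hdm : ∀ a, (domPP w).orderEmbOfFin hD a ∈ domPP w := fun a => Finset.orderEmbOfFin_mem _ _ _
  generalize (rngPP w).orderEmbOfFin hR = s at *
  generalize (domPP w).orderEmbOfFin hD = d at *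
  constructor
  · rw [← Matrix.mulVec_injective_iff_isUnit, ← Matrix.coe_mulVecLin, ← LinearMap.ker_eq_bot,
      LinearMap.ker_eq_bot']
    intro v hv
    ext j
    obtain ⟨i, hi⟩ := mem_domPP.1 (hdm j)
    obtain ⟨a, rfl⟩ := hs i (mem_rngPP.2 ⟨_, hi⟩)
    have := congrFun hv a
    rw [Matrix.mulVecLin_apply, Matrix.mulVec, dotProduct, Finset.sum_eq_single j] at this
    · simpa [hi] using this
    · intro j' _ hne
      rcases h.1 (s a) (d j') with h0 | h0
      · simp [h0]
      · exact absurd (d.injective (h.2.1 _ _ _ h0 hi)) hne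
    · simp
  · ext i j
    simp only [Matrix.mul_apply, Esel, Matrix.transpose_apply, Matrix.submatrix_apply, ite_mul,
      one_mul, zero_mul, mul_ite, mul_one, mul_zero]
    by_cases hw : w i j = 1
    · obtain ⟨a, rfl⟩ := hs i (mem_rngPP.2 ⟨_, hw⟩)
      obtain ⟨b, rfl⟩ := hd j (mem_domPP.2 ⟨_, hw⟩)
      simp
    · have h0 := (h.1 i j).resolve_right hw
      rw [h0]
      symm
      refine Finset.sum_eq_zero fun b _ => ?_
      split_ifs with hj
      · refine Finset.sum_eq_zero fun a _ => ?_
        split_ifs with hi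
        · rw [← hi, ← hj, h0]
        · rfl
      · rfl

lemma backward {m n t : ℕ} {w₁ w₂ : Mat m n} (s r : Fin t ↪o Fin m) (d₁ d₂ : Fin t ↪o Fin n)
    (σ₁ σ₂ : Mat t t) (u₁ : IsUnit σ₁) (u₂ : IsUnit σ₂)
    (e₁ : w₁ = Esel s * σ₁ * (Esel d₁)ᵀ) (e₂ : w₂ = Esel r * σ₂ * (Esel d₂)ᵀ)
    (hrs : ∀ l, r l ≤ s l) (hd : ∀ l, d₁ l ≤ d₂ l) : (dcPlus w₁ ∩ dcMinus w₂).Nonempty := by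
  obtain ⟨p, hp, q, hq, p', hp', q', hq', e⟩ := double_cell σ₁ σ₂ u₁ u₂
  obtain ⟨b, hb, eb⟩ := up_lemma r s hrs p hp
  obtain ⟨c, hc, ec⟩ := lo_lemma r s hrs p' hp'
  obtain ⟨b', hb', eb'⟩ := lo_lemma d₁ d₂ hd qᵀ (Bp_iff.1 hq)
  obtain ⟨c', hc', ec'⟩ := up_lemma d₁ d₂ hd q'ᵀ (Bm_iff.1 hq')
  have fb := congrArg Matrix.transpose eb'
  have fc := congrArg Matrix.transpose ec'
  simp only [Matrix.transpose_mul, Matrix.transpose_transpose] at fb fc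
  refine ⟨Apair r s * (p * σ₁ * q) * (Apair d₁ d₂)ᵀ, ⟨b, hb, b'ᵀ, Bm_iff.1 hb', ?_⟩,
    ⟨c, hc, c'ᵀ, Bp_iff.1 hc', ?_⟩⟩
  · calc _ = (Apair r s * p) * σ₁ * (q * (Apair d₁ d₂)ᵀ) := by simp only [Matrix.mul_assoc]
      _ = _ := by rw [← eb, ← fb, e₁]; simp only [Matrix.mul_assoc]
  · rw [e]
    calc _ = (Apair r s * p') * σ₂ * (q' * (Apair d₁ d₂)ᵀ) := by simp only [Matrix.mul_assoc]
      _ = _ := by rw [← ec, ← fc, e₂]; simp only [Matrix.mul_assoc]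

theorem statement19 (m n t : ℕ) (hm : 0 < m) (hn : 0 < n) (htm : t ≤ m) (htn : t ≤ n)
    (w₁ w₂ : Mat m n) (h₁ : IsPPM w₁) (h₂ : IsPPM w₂)
    (hr₁ : ppmRank w₁ = t) (hr₂ : ppmRank w₂ = t) :
    (dcPlus w₁ ∩ dcMinus w₂).Nonempty ↔
      finsetLE (domPP w₁) (domPP w₂) ∧ finsetLE (rngPP w₂) (rngPP w₁) := by
  have cD₁ := (card_domPP h₁).trans hr₁
  have cD₂ := (card_domPP h₂).trans hr₂
  have cR₁ : (rngPP w₁).card = t := by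
    rw [← domPP_transpose, card_domPP h₁.tr, ppmRank_tr, hr₁]
  have cR₂ : (rngPP w₂).card = t := by
    rw [← domPP_transpose, card_domPP h₂.tr, ppmRank_tr, hr₂]
  constructor
  · rintro ⟨x, hx, hx'⟩
    refine ⟨forward_dom h₁ h₂ hr₁ hr₂ hx hx', ?_⟩
    rw [← domPP_transpose, ← domPP_transpose]
    exact forward_dom h₂.tr h₁.tr ((ppmRank_tr _).trans hr₂) ((ppmRank_tr _).trans hr₁)
      (dcMinus_tr hx') (dcPlus_tr hx)
  · rintro ⟨hD, hR⟩
    obtain ⟨u₁, e₁⟩ := ppm_decomp h₁ cD₁ cR₁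
    obtain ⟨u₂, e₂⟩ := ppm_decomp h₂ cD₂ cR₂
    exact backward _ _ _ _ _ _ u₁ u₂ e₁ e₂ ((finsetLE_iff cR₂ cR₁).1 hR)
      ((finsetLE_iff cD₁ cD₂).1 hD)
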